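/- arXiv:0908.3832 — 10 statements merged into one kernel-verified Lean document; each statement's English description precedes it below -/
import Mathlib

section
/- Let n be a positive integer with n ∣ u_n, and let p be a prime. Then np ∣ u_{np} if and only if p divides u_n·Δ. -/
/-- Lucas sequence of the first kind: `u 0 = 0`, `u 1 = 1`,
`u (n+2) = P * u (n+1) - Q * u n`. -/
def lucasU (P Q : ℤ) : ℕ → ℤ
  | 0 => 0
  | 1 => 1
  | n + 2 => P * lucasU P Q (n + 1) - Q * lucasU P Q n

theorem lucasU_add_two (P Q : ℤ) (n : ℕ) :
    lucasU P Q (n + 2) = P * lucasU P Q (n + 1) - Q * lucasU P Q n := rfl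

/-- Addition formulas for `lucasU`. -/
theorem lucasU_add_and_add_succ (P Q : ℤ) (m n : ℕ) :
    lucasU P Q (m + n) = lucasU P Q m * lucasU P Q (n + 1) + lucasU P Q (m + 1) * lucasU P Q n
        - P * lucasU P Q m * lucasU P Q n ∧
      lucasU P Q (m + n + 1) =
        lucasU P Q (m + 1) * lucasU P Q (n + 1) - Q * lucasU P Q m * lucasU P Q n := by
  induction n with
  | zero => simp [lucasU]
  | succ n ih =>
    obtain ⟨h₀, h₁⟩ := ih
    refine ⟨?_, ?_⟩
    · rw [← add_assoc, h₁, lucasU_add_two]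
      ring
    · rw [show m + (n + 1) + 1 = m + n + 2 by ring, lucasU_add_two, h₀, h₁, lucasU_add_two]
      ring

theorem lucasU_quadratic_form (P Q : ℤ) (n : ℕ) :
    lucasU P Q (n + 1) ^ 2 - P * lucasU P Q n * lucasU P Q (n + 1) + Q * lucasU P Q n ^ 2
      = Q ^ n := by
  induction n with
  | zero => simp [lucasU]
  | succ n ih =>
    rw [lucasU_add_two, pow_succ Q, ← ih]
    ring

/-- Companion Lucas sequence, written in terms of `lucasU`. -/
def lucasV (P Q : ℤ) (n : ℕ) : ℤ := 2 * lucasU P Q (n + 1) - P * lucasU P Q n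

theorem lucasV_sq_sub (P Q : ℤ) (n : ℕ) :
    lucasV P Q n ^ 2 - 4 * Q ^ n = lucasU P Q n ^ 2 * (P ^ 2 - 4 * Q) := by
  rw [← lucasU_quadratic_form P Q n, lucasV]
  ring

theorem lucasU_add_add (P Q : ℤ) (m n : ℕ) :
    lucasU P Q (m + n + n) = lucasV P Q n * lucasU P Q (m + n) - Q ^ n * lucasU P Q m := by
  rw [(lucasU_add_and_add_succ P Q (m + n) n).1, (lucasU_add_and_add_succ P Q m n).1,
    (lucasU_add_and_add_succ P Q m n).2, ← lucasU_quadratic_form P Q n, lucasV]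
  ring

theorem lucasU_mul (P Q : ℤ) (n k : ℕ) :
    lucasU P Q (n * k) = lucasU P Q n * lucasU (lucasV P Q n) (Q ^ n) k := by
  induction k using Nat.twoStepInduction with
  | zero => simp [lucasU]
  | one => simp [lucasU]
  | more k ih₀ ih₁ =>
    rw [mul_add_one] at ih₁
    rw [show n * (k + 2) = n * k + n + n by ring, lucasU_add_add, ih₀, ih₁, lucasU_add_two]
    ring

theorem lucasU_cast_eq_geom_sum {R : Type*} [CommRing R] (A B : ℤ) (a b : R)
    (hA : (A : R) = a + b) (hB : (B : R) = a * b) (n : ℕ) :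
    (lucasU A B n : R) = ∑ i ∈ Finset.range n, a ^ i * b ^ (n - 1 - i) := by
  have key (n : ℕ) : (lucasU A B (n + 1) : R) = b * lucasU A B n + a ^ n := by
    induction n with
    | zero => simp [lucasU]
    | succ n ih =>
      rw [lucasU_add_two]
      push_cast
      rw [hA, hB, pow_succ]
      linear_combination a * ih
  induction n with
  | zero => simp [lucasU]
  | succ n ih =>
    rw [key, ih, add_comm]
    exact (Commute.all a b).geom_sum₂_succ_eq.symm

theorem prime_dvd_lucasU_iff (A B : ℤ) {p : ℕ} (hp : p.Prime) :
    (p : ℤ) ∣ lucasU A B p ↔ (p : ℤ) ∣ A ^ 2 - 4 * B := by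
  have : Fact p.Prime := ⟨hp⟩
  let K := AlgebraicClosure (ZMod p)
  have : CharP K p := charP_of_injective_algebraMap (algebraMap (ZMod p) K).injective p
  obtain ⟨a, ha⟩ : ∃ a : K, a * a - A * a + B = 0 := by
    obtain ⟨a, ha⟩ := IsAlgClosed.exists_root
      (Polynomial.C 1 * Polynomial.X ^ 2 + Polynomial.C (-(A : K)) * Polynomial.X
        + Polynomial.C (B : K))
      (by rw [Polynomial.degree_quadratic one_ne_zero]; decide)
    refine ⟨a, ?_⟩
    simp only [Polynomial.IsRoot.def, Polynomial.eval_add, Polynomial.eval_mul, Polynomial.eval_C,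
      Polynomial.eval_pow, Polynomial.eval_X] at ha
    linear_combination ha
  have hA : (A : K) = a + (A - a) := by ring
  have hB : (B : K) = a * (A - a) := by linear_combination ha
  generalize (A : K) - a = b at hA hB
  rw [← CharP.intCast_eq_zero_iff K p, ← CharP.intCast_eq_zero_iff K p]
  have hD : ((A ^ 2 - 4 * B : ℤ) : K) = (a - b) ^ 2 := by
    push_cast
    rw [hA, hB]
    ring
  have hU := lucasU_cast_eq_geom_sum A B a b hA hB p
  rw [hD, pow_eq_zero_iff two_ne_zero, sub_eq_zero]
  constructor
  · intro h
    have := geom_sum₂_mul a b p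
    rw [← hU, h, zero_mul, ← sub_pow_char a b] at this
    exact sub_eq_zero.mp (pow_eq_zero_iff hp.ne_zero |>.mp this.symm)
  · rintro rfl
    rw [hU, geom_sum₂_self, CharP.cast_eq_zero, zero_mul]

/-- For `n ∈ S` and `p` prime, `np ∈ S` iff `p ∣ u_n · Δ`. -/
theorem lucasU_mul_prime_mem_S_iff (P Q : ℤ) (n : ℕ) (hn : 0 < n)
    (hnS : (n : ℤ) ∣ lucasU P Q n) (p : ℕ) (hp : p.Prime) :
    ((n * p : ℕ) : ℤ) ∣ lucasU P Q (n * p) ↔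
      (p : ℤ) ∣ lucasU P Q n * (P ^ 2 - 4 * Q) := by
  have hn' : (n : ℤ) ≠ 0 := by exact_mod_cast hn.ne'
  have hp' : Prime (p : ℤ) := Nat.prime_iff_prime_int.mp hp
  have hU : (p : ℤ) ∣ lucasU (lucasV P Q n) (Q ^ n) p ↔
      (p : ℤ) ∣ lucasU P Q n * (P ^ 2 - 4 * Q) := by
    rw [prime_dvd_lucasU_iff _ _ hp, lucasV_sq_sub, hp'.dvd_mul, hp'.dvd_mul,
      hp'.dvd_pow_iff_dvd two_ne_zero]
  rw [lucasU_mul, Nat.cast_mul]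
  constructor
  · intro h
    rcases hp'.dvd_or_dvd ((dvd_mul_left _ _).trans h) with h | h
    · exact h.mul_right _
    · exact hU.mp h
  · exact fun h => mul_dvd_mul hnS (hU.mpr h)
end

section
/- One has 6 ∣ u_6 while 2 ∤ u_2 and 3 ∤ u_3 (i.e., 6 ∈ S but 2 ∉ S and 3 ∉ S) if and only if P ≡ 3 (mod 6) and Q ≡ 1 or 5 (mod 6). -/
/-- `6 ∈ S`, `2 ∉ S`, `3 ∉ S` iff `P ≡ 3 (mod 6)` and `Q ≡ ±1 (mod 6)`. -/
theorem six_basic_iff (P Q : ℤ) :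
    ((6 : ℤ) ∣ lucasU P Q 6 ∧ ¬ (2 : ℤ) ∣ lucasU P Q 2 ∧ ¬ (3 : ℤ) ∣ lucasU P Q 3) ↔
      (P % 6 = 3 ∧ (Q % 6 = 1 ∨ Q % 6 = 5)) := by
  have h2 : lucasU P Q 2 = P := by simp [lucasU]
  have h3 : lucasU P Q 3 = P * P - Q := by simp [lucasU]
  have h6 : lucasU P Q 6 = P * (P * P - Q) * (P * P - 3 * Q) := by
    simp only [lucasU]
    ring
  rw [h2, h3, h6]
  simp only [Int.dvd_iff_emod_eq_zero]
  have hP : P % 6 = 0 ∨ P % 6 = 1 ∨ P % 6 = 2 ∨ P % 6 = 3 ∨ P % 6 = 4 ∨ P % 6 = 5 := by omega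
  have hQ : Q % 6 = 0 ∨ Q % 6 = 1 ∨ Q % 6 = 2 ∨ Q % 6 = 3 ∨ Q % 6 = 4 ∨ Q % 6 = 5 := by omega
  have hP2 : P % 2 = P % 6 % 2 := by omega
  have hP3 : (P * P - Q) % 3 = (P * P - Q) % 6 % 3 := by omega
  rw [hP2, hP3]
  rcases hP with h | h | h | h | h | h <;> rcases hQ with k | k | k | k | k | k <;>
    simp [Int.mul_emod, Int.sub_emod, h, k]
end

section
/- One has 12 ∣ u_{12} while 6 ∤ u_6 and 4 ∤ u_4 (i.e., 12 ∈ S but 6 ∉ S and 4 ∉ S) if and only if P ≡ 1 or 5 (mod 6) and Q ≡ 5 (mod 6). -/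
/-- The Lucas sequence modulo `m` depends only on its parameters modulo `m`. -/
theorem lucasU_modEq {m P Q P' Q' : ℤ} (hP : P ≡ P' [ZMOD m]) (hQ : Q ≡ Q' [ZMOD m]) (n : ℕ) :
    lucasU P Q n ≡ lucasU P' Q' n [ZMOD m] := by
  induction n using Nat.twoStepInduction with
  | zero => rfl
  | one => rfl
  | more n ih₀ ih₁ => exact (hP.mul ih₁).sub (hQ.mul ih₀)

/-- Replacing the parameters by their residues modulo `m` preserves divisibility by divisors
of `m`. -/
theorem dvd_lucasU_emod_iff {d m : ℤ} (h : d ∣ m) (P Q : ℤ) (n : ℕ) :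
    d ∣ lucasU (P % m) (Q % m) n ↔ d ∣ lucasU P Q n :=
  (lucasU_modEq ((Int.mod_modEq P m).of_dvd h) ((Int.mod_modEq Q m).of_dvd h) n).dvd_iff

theorem twelve_basic_iff_of_residues : ∀ p ∈ Finset.Ico (0 : ℤ) 12, ∀ q ∈ Finset.Ico (0 : ℤ) 12,
    (((12 : ℤ) ∣ lucasU p q 12 ∧ ¬ (6 : ℤ) ∣ lucasU p q 6 ∧ ¬ (4 : ℤ) ∣ lucasU p q 4) ↔
      ((p % 6 = 1 ∨ p % 6 = 5) ∧ q % 6 = 5)) := by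
  decide +kernel

/-- `12 ∈ S`, `6 ∉ S`, `4 ∉ S` iff `P ≡ ±1 (mod 6)` and `Q ≡ -1 (mod 6)`. -/
theorem twelve_basic_iff (P Q : ℤ) :
    ((12 : ℤ) ∣ lucasU P Q 12 ∧ ¬ (6 : ℤ) ∣ lucasU P Q 6 ∧ ¬ (4 : ℤ) ∣ lucasU P Q 4) ↔
      ((P % 6 = 1 ∨ P % 6 = 5) ∧ Q % 6 = 5) := by
  have mem_Ico (a : ℤ) : a % 12 ∈ Finset.Ico (0 : ℤ) 12 :=
    Finset.mem_Ico.2 ⟨Int.emod_nonneg a (by norm_num), Int.emod_lt_of_pos a (by norm_num)⟩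
  have emod_six (a : ℤ) : a % 12 % 6 = a % 6 := Int.emod_emod_of_dvd a (by norm_num)
  have h := twelve_basic_iff_of_residues (P % 12) (mem_Ico P) (Q % 12) (mem_Ico Q)
  rwa [dvd_lucasU_emod_iff (by norm_num), dvd_lucasU_emod_iff (by norm_num),
    dvd_lucasU_emod_iff (by norm_num), emod_six, emod_six] at h
end

section
/- If P is odd, ℓ ≥ 3, and 2^ℓ·3 divides u_{2^ℓ·3}, then 2^{ℓ−1}·3 divides u_{2^{ℓ−1}·3}. In particular, then 12 divides u_{12}. -/
theorem lucasU_add_add_one (P Q : ℤ) (m n : ℕ) :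
    lucasU P Q (m + n + 1) =
      lucasU P Q (m + 1) * lucasU P Q (n + 1) - Q * lucasU P Q m * lucasU P Q n := by
  induction n generalizing m with
  | zero => simp [lucasU]
  | succ n ih =>
    have h := ih (m + 1)
    rw [show m + 1 + n + 1 = m + (n + 1) + 1 by ring, show m + 1 + 1 = m + 2 by ring] at h
    rw [h, show n + 1 + 1 = n + 2 by ring, lucasU_add_two, lucasU_add_two]
    ring

theorem lucasU_two_mul (P Q : ℤ) (n : ℕ) :
    lucasU P Q (2 * n) = lucasU P Q n * (2 * lucasU P Q (n + 1) - P * lucasU P Q n) := by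
  cases n with
  | zero => simp [lucasU]
  | succ k =>
    rw [show 2 * (k + 1) = (k + 1) + k + 1 by ring, lucasU_add_add_one,
      show k + 1 + 1 = k + 2 by ring, lucasU_add_two]
    ring

theorem dvd_lucasU_mul {P Q d : ℤ} {m : ℕ} (h : d ∣ lucasU P Q m) (k : ℕ) :
    d ∣ lucasU P Q (m * k) := by
  cases m with
  | zero => simp [lucasU]
  | succ m =>
    induction k with
    | zero => simp [lucasU]
    | succ k ih =>
      rw [show (m + 1) * (k + 1) = (m + 1) * k + m + 1 by ring, lucasU_add_add_one]
      exact dvd_sub (h.mul_left _) ((ih.mul_left _).mul_right _)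

/-- A prime dividing `Q` but not `P` divides no term of positive index. -/
theorem not_dvd_lucasU_succ {P Q p : ℤ} (hp : Prime p) (hQ : p ∣ Q) (hP : ¬ p ∣ P) (n : ℕ) :
    ¬ p ∣ lucasU P Q (n + 1) := by
  induction n with
  | zero => simpa [lucasU] using hp.not_isUnit ∘ isUnit_of_dvd_one
  | succ n ih =>
    rw [show n + 1 + 1 = n + 2 by ring, lucasU_add_two, dvd_sub_left (hQ.mul_right _),
      hp.dvd_mul]
    tauto

theorem four_dvd_lucasU_six {P Q : ℤ} (hP : Odd P) (hQ : Odd Q) : (4 : ℤ) ∣ lucasU P Q 6 := by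
  obtain ⟨a, rfl⟩ := hP
  obtain ⟨b, rfl⟩ := hQ
  have h : lucasU (2 * a + 1) (2 * b + 1) 6 =
      (2 * a + 1) * ((2 * a + 1) ^ 2 - (2 * b + 1)) *
        ((2 * a + 1) ^ 2 - 3 * (2 * b + 1)) := by
    simp only [lucasU]
    ring
  rw [h]
  exact ⟨(2 * a + 1) * (2 * a ^ 2 + 2 * a - b) * (2 * a ^ 2 + 2 * a - 3 * b - 1), by ring⟩

theorem odd_lucasU_six_mul_add_one {P Q : ℤ} (hP : Odd P) (hQ : Odd Q) (k : ℕ) :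
    Odd (lucasU P Q (6 * k + 1)) := by
  have heven : ∀ j, Even (lucasU P Q (6 * j)) := fun j =>
    even_iff_two_dvd.2 ((by norm_num : (2 : ℤ) ∣ 4).trans
      (dvd_lucasU_mul (four_dvd_lucasU_six hP hQ) j))
  induction k with
  | zero => simp [lucasU]
  | succ k ih =>
    have h7 : Odd (lucasU P Q 7) := by
      have h6 := heven 1
      have h5 : Odd (lucasU P Q 5) := by
        have h3 : Even (lucasU P Q 3) := by
          simpa [lucasU] using (hP.mul hP).sub_odd hQ
        have h4 : Odd (lucasU P Q 4) := by
          rw [show (4 : ℕ) = 2 + 2 by rfl, lucasU_add_two]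
          exact (h3.mul_left _).sub_odd (hQ.mul (by simpa [lucasU] using hP))
        rw [show (5 : ℕ) = 3 + 2 by rfl, lucasU_add_two]
        exact (hP.mul h4).sub_even (h3.mul_left _)
      rw [show (7 : ℕ) = 5 + 2 by rfl, lucasU_add_two]
      exact (h6.mul_left _).sub_odd (hQ.mul h5)
    rw [show 6 * (k + 1) + 1 = 6 * k + 6 + 1 by ring, lucasU_add_add_one]
    exact (ih.mul h7).sub_even (((heven k).mul_left _).mul_right _)

theorem pow_dvd_lucasU_six_mul {P Q : ℤ} (hP : Odd P) (hQ : Odd Q) {j k : ℕ}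
    (h : (2 : ℤ) ^ (j + 1) ∣ lucasU P Q (2 * (6 * k))) : (2 : ℤ) ^ j ∣ lucasU P Q (6 * k) := by
  obtain ⟨c, hc⟩ := dvd_lucasU_mul (four_dvd_lucasU_six hP hQ) k
  have hodd : Odd (lucasU P Q (6 * k + 1) - P * (2 * c)) :=
    (odd_lucasU_six_mul_add_one hP hQ k).sub_even ((even_two_mul c).mul_left _)
  have hfac : lucasU P Q (2 * (6 * k)) =
      2 * (lucasU P Q (6 * k) * (lucasU P Q (6 * k + 1) - P * (2 * c))) := by
    rw [lucasU_two_mul, hc]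
    ring
  rw [hfac, pow_succ', mul_dvd_mul_iff_left two_ne_zero] at h
  exact (Int.isCoprime_two_left.2 hodd).pow_left.dvd_of_dvd_mul_right h

theorem three_dvd_lucasU_twelve {P Q : ℤ} (h : 3 ∣ Q → 3 ∣ P) : (3 : ℤ) ∣ lucasU P Q 12 := by
  have key : ∀ p q : ZMod 3, (q = 0 → p = 0) →
      p * (p ^ 2 - q) * (p ^ 2 - 3 * q) * (p ^ 2 - 2 * q) * (p ^ 4 - 4 * p ^ 2 * q + q ^ 2) = 0 := by
    decide
  have hfac : lucasU P Q 12 =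
      P * (P ^ 2 - Q) * (P ^ 2 - 3 * Q) * (P ^ 2 - 2 * Q) * (P ^ 4 - 4 * P ^ 2 * Q + Q ^ 2) := by
    simp only [lucasU]
    ring
  have h' := key P Q (by simpa [ZMod.intCast_zmod_eq_zero_iff_dvd] using h)
  rw [hfac, ← Nat.cast_ofNat, ← ZMod.intCast_zmod_eq_zero_iff_dvd]
  exact_mod_cast h'

/-- If `P` is odd, `ℓ ≥ 3` and `2^ℓ·3 ∈ S`, then `2^(ℓ-1)·3 ∈ S`;
in particular `12 ∈ S`. -/
theorem pow_two_mul_three_mem_S (P Q : ℤ) (hP : Odd P) (ℓ : ℕ) (hℓ : 3 ≤ ℓ)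
    (h : ((2 ^ ℓ * 3 : ℕ) : ℤ) ∣ lucasU P Q (2 ^ ℓ * 3)) :
    ((2 ^ (ℓ - 1) * 3 : ℕ) : ℤ) ∣ lucasU P Q (2 ^ (ℓ - 1) * 3) ∧
      (12 : ℤ) ∣ lucasU P Q 12 := by
  have h2 : ¬ (2 : ℤ) ∣ P := by rwa [← even_iff_two_dvd, Int.not_even_iff_odd]
  obtain ⟨m, rfl⟩ := Nat.exists_eq_add_of_le' hℓ
  have hpos : 2 ^ (m + 3) * 3 = (2 ^ (m + 3) * 3 - 1) + 1 := by
    have : 0 < 2 ^ (m + 3) := by positivity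
    omega
  have hndvd : ∀ p : ℤ, Prime p → p ∣ 2 ^ (m + 3) * 3 → p ∣ Q → p ∣ P := by
    intro p hp hpd hpQ
    by_contra hpP
    apply not_dvd_lucasU_succ hp hpQ hpP (2 ^ (m + 3) * 3 - 1)
    rw [← hpos]
    refine dvd_trans ?_ h
    exact_mod_cast hpd
  have hQ : Odd Q := by
    rw [← Int.not_even_iff_odd, even_iff_two_dvd]
    exact fun hQ => h2 (hndvd 2 Int.prime_two ((dvd_pow_self 2 (by omega)).mul_right 3) hQ)
  have h3 : (3 : ℤ) ∣ lucasU P Q 12 :=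
    three_dvd_lucasU_twelve (hndvd 3 Int.prime_three (dvd_mul_left _ _))
  have h12 : (4 : ℤ) ∣ lucasU P Q 12 := dvd_lucasU_mul (four_dvd_lucasU_six hP hQ) 2
  refine ⟨?_, by omega⟩
  have hpow : (2 : ℤ) ^ (m + 2) ∣ lucasU P Q (2 ^ (m + 2) * 3) := by
    rw [show 2 ^ (m + 2) * 3 = 6 * 2 ^ (m + 1) by ring]
    apply pow_dvd_lucasU_six_mul hP hQ
    rw [show 2 * (6 * 2 ^ (m + 1)) = 2 ^ (m + 3) * 3 by ring]
    refine dvd_trans ?_ h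
    push_cast
    exact dvd_mul_right _ _
  have h3' : (3 : ℤ) ∣ lucasU P Q (2 ^ (m + 2) * 3) := by
    rw [show 2 ^ (m + 2) * 3 = 12 * 2 ^ m by ring]
    exact dvd_lucasU_mul h3 _
  rw [show m + 3 - 1 = m + 2 by rfl]
  push_cast
  exact (IsCoprime.pow_left (by norm_num)).mul_dvd hpow h3'
end

section
/- For any prime p, p divides u_p if and only if p divides Δ = P² − 4Q. -/
/-- Binet's formula for `lucasU`, without division by the difference of the roots. -/
theorem sub_mul_cast_lucasU {R : Type*} [CommRing R] {P Q : ℤ} {a b : R}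
    (hP : (P : R) = a + b) (hQ : (Q : R) = a * b) (n : ℕ) :
    (a - b) * (lucasU P Q n : R) = a ^ n - b ^ n := by
  induction n using Nat.twoStepInduction with
  | zero => simp [lucasU]
  | one => simp [lucasU]
  | more n ih₀ ih₁ =>
    simp only [lucasU, Int.cast_sub, Int.cast_mul, hP, hQ]
    linear_combination (a + b) * ih₁ - a * b * ih₀

/-- The value of `lucasU` when the characteristic polynomial has a double root. -/
theorem cast_lucasU_succ_of_double_root {R : Type*} [CommRing R] {P Q : ℤ} {a : R}
    (hP : (P : R) = a + a) (hQ : (Q : R) = a * a) (n : ℕ) :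
    (lucasU P Q (n + 1) : R) = (n + 1) * a ^ n := by
  induction n using Nat.twoStepInduction with
  | zero => simp [lucasU]
  | one => simp [lucasU, hP]; ring
  | more n ih₀ ih₁ =>
    rw [lucasU, Int.cast_sub, Int.cast_mul, Int.cast_mul, ih₀, ih₁, hP, hQ]
    push_cast
    ring

/-- A monic quadratic over an algebraically closed field has two roots with multiplicity. -/
theorem exists_add_eq_and_mul_eq {K : Type*} [Field K] [IsAlgClosed K] (s t : K) :
    ∃ a b : K, s = a + b ∧ t = a * b := by
  obtain ⟨a, ha⟩ := IsAlgClosed.exists_root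
    (Polynomial.C 1 * Polynomial.X ^ 2 + Polynomial.C (-s) * Polynomial.X + Polynomial.C t)
    (by rw [Polynomial.degree_quadratic one_ne_zero]; decide)
  simp only [Polynomial.IsRoot.def, Polynomial.eval_add, Polynomial.eval_mul, Polynomial.eval_pow,
    Polynomial.eval_C, Polynomial.eval_X] at ha
  exact ⟨a, s - a, by ring, by linear_combination ha⟩

/-- For any prime `p`, `p ∣ u_p` iff `p ∣ Δ = P² - 4Q`. -/
theorem prime_dvd_lucasU_self_iff (P Q : ℤ) (p : ℕ) (hp : p.Prime) :
    (p : ℤ) ∣ lucasU P Q p ↔ (p : ℤ) ∣ P ^ 2 - 4 * Q := by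
  have := Fact.mk hp
  let K := AlgebraicClosure (ZMod p)
  have : CharP K p := charP_of_injective_algebraMap (algebraMap (ZMod p) K).injective p
  obtain ⟨a, b, hP, hQ⟩ := exists_add_eq_and_mul_eq (P : K) (Q : K)
  have hΔ : ((P ^ 2 - 4 * Q : ℤ) : K) = (a - b) ^ 2 := by
    rw [Int.cast_sub, Int.cast_pow, Int.cast_mul, hP, hQ, Int.cast_ofNat]
    ring
  rw [← CharP.intCast_eq_zero_iff K p, ← CharP.intCast_eq_zero_iff K p, hΔ, sq_eq_zero_iff]
  constructor
  · intro hu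
    have h := sub_mul_cast_lucasU hP hQ p
    rw [hu, mul_zero, ← sub_pow_char] at h
    exact eq_zero_of_pow_eq_zero h.symm
  · intro hab
    obtain rfl := sub_eq_zero.mp hab
    have h := cast_lucasU_succ_of_double_root hP hQ (p - 1)
    rw [← Nat.cast_add_one, Nat.sub_add_cancel hp.one_le, CharP.cast_eq_zero, zero_mul] at h
    exact h
end

section
/- If p is an odd prime with p ∤ Q and p ∤ Δ, then p divides u_{p−ε}, where ε = (Δ/p) is the Legendre symbol of Δ modulo p (so ε = ±1 since p ∤ Δ). -/
/-- Binet's formula, without division: if `a` and `b` are the roots of `X ^ 2 - P * X + Q`,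
then `(a - b) * u n = a ^ n - b ^ n`. -/
theorem sub_mul_lucasU_eq_pow_sub_pow {R : Type*} [CommRing R] {P Q : ℤ} {a b : R}
    (hadd : a + b = P) (hmul : a * b = Q) (n : ℕ) :
    (a - b) * (lucasU P Q n : R) = a ^ n - b ^ n := by
  induction n using Nat.twoStepInduction with
  | zero => simp [lucasU]
  | one => simp [lucasU]
  | more n ih₀ ih₁ =>
    rw [lucasU]
    push_cast
    rw [← hadd, ← hmul]
    linear_combination (a + b) * ih₁ - a * b * ih₀

theorem intCast_pow_char {R : Type*} [CommRing R] (p : ℕ) [Fact p.Prime] [CharP R p] (m : ℤ) :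
    (m : R) ^ p = m := by
  have h := congrArg (ZMod.castHom dvd_rfl R) (ZMod.pow_card (m : ZMod p))
  simpa only [map_pow, map_intCast] using h

/-- A square root of the integer `D` in characteristic `p` is multiplied by the Legendre symbol
of `D` under Frobenius. -/
theorem pow_char_eq_legendreSym_mul {R : Type*} [CommRing R] {p : ℕ} [Fact p.Prime] [CharP R p]
    (hp2 : p ≠ 2) {D : ℤ} {d : R} (hd : d ^ 2 = D) : d ^ p = legendreSym p D * d := by
  have h := congrArg (ZMod.castHom dvd_rfl R) (legendreSym.eq_pow p D)
  simp only [map_pow, map_intCast] at h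
  rw [h, ← hd, ← pow_mul, ← pow_succ,
    Nat.two_mul_div_two_add_one_of_odd ((Fact.out : p.Prime).odd_of_ne_two hp2)]

/-- Frobenius acts on the roots `(P ± d) / 2` through its action on `d`. -/
theorem two_mul_pow_char {R : Type*} [CommRing R] {p : ℕ} [Fact p.Prime] [CharP R p]
    {a d : R} {P : ℤ} (ha : 2 * a = P + d) : 2 * a ^ p = P + d ^ p := by
  have h := congrArg (· ^ p) ha
  have h2 : (2 : R) ^ p = 2 := by exact_mod_cast intCast_pow_char (R := R) p 2
  simpa only [mul_pow, add_pow_char, intCast_pow_char, h2] using h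

/-- If `p` is an odd prime with `p ∤ Q` and `p ∤ Δ`, then
`p ∣ u_{p - ε}` where `ε = (Δ/p)` is the Legendre symbol. -/
theorem prime_dvd_lucasU_sub_legendreSym (P Q : ℤ) (p : ℕ) (hp : p.Prime) (hp2 : p ≠ 2)
    (hQ : ¬ (p : ℤ) ∣ Q) (hD : ¬ (p : ℤ) ∣ P ^ 2 - 4 * Q) :
    (p : ℤ) ∣ lucasU P Q ((p : ℤ) - @legendreSym p ⟨hp⟩ (P ^ 2 - 4 * Q)).toNat := by
  have : Fact p.Prime := ⟨hp⟩
  let K := AlgebraicClosure (ZMod p)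
  have : CharP K p := charP_of_injective_algebraMap (algebraMap (ZMod p) K).injective p
  have hQ0 : (Q : K) ≠ 0 := mt (CharP.intCast_eq_zero_iff K p Q).1 hQ
  have hD0 : ((P ^ 2 - 4 * Q : ℤ) : K) ≠ 0 := mt (CharP.intCast_eq_zero_iff K p _).1 hD
  have h2 : (2 : K) ≠ 0 := Ring.two_ne_zero (by rwa [ringChar.eq K p])
  obtain ⟨d, hd⟩ := IsAlgClosed.exists_pow_nat_eq ((P ^ 2 - 4 * Q : ℤ) : K) two_pos
  have hd0 : d ≠ 0 := by
    rintro rfl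
    exact hD0 (by rw [← hd]; simp)
  have hdp := pow_char_eq_legendreSym_mul hp2 hd
  obtain ⟨a, ha⟩ : ∃ a : K, 2 * a = P + d := ⟨2⁻¹ * (P + d), mul_inv_cancel_left₀ h2 _⟩
  obtain ⟨b, hb⟩ : ∃ b : K, 2 * b = P + -d := ⟨2⁻¹ * (P + -d), mul_inv_cancel_left₀ h2 _⟩
  have hadd : a + b = P := mul_left_cancel₀ h2 (by linear_combination ha + hb)
  have hsub : a - b = d := mul_left_cancel₀ h2 (by linear_combination ha - hb)
  have hmul : a * b = Q := by
    push_cast at hd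
    refine mul_left_cancel₀ (mul_ne_zero h2 h2) ?_
    linear_combination 2 * b * ha + (P + d) * hb - hd
  have hap := two_mul_pow_char (p := p) ha
  have hbp := two_mul_pow_char (p := p) hb
  rw [(hp.odd_of_ne_two hp2).neg_pow] at hbp
  rw [hdp] at hap hbp
  rw [← CharP.intCast_eq_zero_iff K p]
  refine (mul_eq_zero.1 ?_).resolve_left hd0
  rw [← hsub, sub_mul_lucasU_eq_pow_sub_pow hadd hmul, sub_eq_zero]
  have hDp : ((P ^ 2 - 4 * Q : ℤ) : ZMod p) ≠ 0 :=
    mt (CharP.intCast_eq_zero_iff (ZMod p) p _).1 hD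
  rcases legendreSym.eq_one_or_neg_one p hDp with h | h
  · rw [h] at hap hbp ⊢
    push_cast at hap hbp
    have ha0 : a ≠ 0 := left_ne_zero_of_mul (hmul ▸ hQ0)
    have hb0 : b ≠ 0 := right_ne_zero_of_mul (hmul ▸ hQ0)
    have hap' : a ^ p = a := mul_left_cancel₀ h2 (by linear_combination hap - ha)
    have hbp' : b ^ p = b := mul_left_cancel₀ h2 (by linear_combination hbp - hb)
    have hn : ((p : ℤ) - 1).toNat = p - 1 := by omega
    rw [← pow_sub_one_mul hp.ne_zero] at hap' hbp'
    rw [hn, (mul_eq_right₀ ha0).1 hap', (mul_eq_right₀ hb0).1 hbp']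
  · rw [h] at hap hbp ⊢
    push_cast at hap hbp
    have hap' : a ^ p = b := mul_left_cancel₀ h2 (by linear_combination hap - hb)
    have hbp' : b ^ p = a := mul_left_cancel₀ h2 (by linear_combination hbp - ha)
    have hn : ((p : ℤ) - -1).toNat = p + 1 := by omega
    rw [hn, pow_succ, pow_succ, hap', hbp', mul_comm]
end

section
/- If P is odd and 2^ℓ divides u_{12} for some ℓ ≥ 1, then 2^{ℓ−1} divides u_6. -/
/-- The factorization `u 12 = u 6 * v 6`, where `v 6 = (v 3)^2 - 2 * Q^3` and
`v 3 = P * (P^2 - 3 * Q)` belong to the companion sequence. -/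
theorem lucasU_twelve (P Q : ℤ) :
    lucasU P Q 12 = lucasU P Q 6 * ((P * (P ^ 2 - 3 * Q)) ^ 2 - 2 * Q ^ 3) := by
  simp only [lucasU]
  ring

/-- For odd `P`, the companion term `v 6` is not divisible by `4`. -/
theorem exists_odd_companion_six_dvd (P Q : ℤ) (hP : Odd P) :
    ∃ m : ℤ, Odd m ∧ (P * (P ^ 2 - 3 * Q)) ^ 2 - 2 * Q ^ 3 ∣ 2 * m := by
  rcases Int.even_or_odd Q with hQ | hQ
  · refine ⟨_, ?_, dvd_mul_left _ _⟩
    exact ((hP.mul (hP.pow.sub_even (hQ.mul_left 3))).pow).sub_even (even_two_mul _)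
  · obtain ⟨w, hw⟩ : Even (P ^ 2 - 3 * Q) :=
      hP.pow.sub_odd (Odd.mul (by decide) hQ)
    refine ⟨2 * (P * w) ^ 2 - Q ^ 3, (even_two_mul _).sub_odd hQ.pow, dvd_of_eq ?_⟩
    rw [hw]
    ring

/-- If `P` is odd and `2^ℓ ∣ u_{12}` for some `ℓ ≥ 1`,
then `2^(ℓ-1) ∣ u_6`. -/
theorem two_pow_dvd_lucasU_six (P Q : ℤ) (hP : Odd P) (ℓ : ℕ) (hℓ : 1 ≤ ℓ)
    (h : (2 : ℤ) ^ ℓ ∣ lucasU P Q 12) : (2 : ℤ) ^ (ℓ - 1) ∣ lucasU P Q 6 := by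
  obtain ⟨m, hm, hdvd⟩ := exists_odd_companion_six_dvd P Q hP
  have hdiv : (2 : ℤ) ^ ℓ ∣ lucasU P Q 6 * (2 * m) :=
    (lucasU_twelve P Q ▸ h).trans (mul_dvd_mul_left _ hdvd)
  obtain ⟨k, rfl⟩ := Nat.exists_eq_add_of_le' hℓ
  rw [Nat.add_sub_cancel]
  rw [pow_succ, mul_comm ((2 : ℤ) ^ k), mul_left_comm] at hdiv
  have hcop : IsCoprime ((2 : ℤ) ^ k) m := (Int.isCoprime_two_left.mpr hm).pow_left
  exact hcop.dvd_of_dvd_mul_right (Int.dvd_of_mul_dvd_mul_left two_ne_zero hdiv)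
end

section
/- For any positive integer k, if 3 divides u_{8k}, then 3 divides u_{4k}. -/
/-- The shift `(u n, u (n+1)) ↦ (u (n+1), u (n+2))` of a Lucas sequence modulo `3`. -/
def lucasStep (p q : ZMod 3) (x : ZMod 3 × ZMod 3) : ZMod 3 × ZMod 3 :=
  (x.2, p * x.2 - q * x.1)

theorem lucasStep_iterate (P Q : ℤ) (n : ℕ) :
    (lucasStep P Q)^[n] (0, 1) = ((lucasU P Q n : ZMod 3), (lucasU P Q (n + 1) : ZMod 3)) := by
  induction n with
  | zero => simp [lucasU]
  | succ n ih =>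
    rw [Function.iterate_succ_apply', ih]
    simp [lucasStep, lucasU]

theorem three_dvd_lucasU_iff (P Q : ℤ) (n : ℕ) :
    (3 : ℤ) ∣ lucasU P Q n ↔ ((lucasStep P Q)^[n] (0, 1)).1 = 0 := by
  rw [lucasStep_iterate]
  exact (ZMod.intCast_zmod_eq_zero_iff_dvd _ 3).symm

set_option maxRecDepth 10000 in
theorem lucasStep_iterate_twenty_six (p q : ZMod 3) :
    (lucasStep p q)^[26] (0, 1) = (lucasStep p q)^[2] (0, 1) := by
  revert p q
  decide

theorem lucasStep_iterate_add_twenty_four (p q : ZMod 3) {n : ℕ} (hn : 1 < n) :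
    (lucasStep p q)^[n + 24] (0, 1) = (lucasStep p q)^[n] (0, 1) := by
  obtain ⟨m, rfl⟩ := Nat.exists_eq_add_of_lt hn
  rw [show 1 + m + 1 + 24 = m + 26 by ring, show 1 + m + 1 = m + 2 by ring,
    Function.iterate_add_apply, lucasStep_iterate_twenty_six, ← Function.iterate_add_apply]

set_option maxRecDepth 10000 in
theorem lucasStep_iterate_four_mul (p q : ZMod 3) :
    ∀ k : ℕ, 0 < k → ((lucasStep p q)^[8 * k] (0, 1)).1 = 0 →
      ((lucasStep p q)^[4 * k] (0, 1)).1 = 0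
  | 0 => fun hk => absurd hk (lt_irrefl 0)
  | 1 => fun _ => by revert p q; decide
  | 2 => fun _ => by revert p q; decide
  | 3 => fun _ => by revert p q; decide
  | 4 => fun _ => by revert p q; decide
  | 5 => fun _ => by revert p q; decide
  | 6 => fun _ => by revert p q; decide
  | k + 7 => fun _ h => by
    have ih := lucasStep_iterate_four_mul p q (k + 1) k.succ_pos
    rw [show 8 * (k + 7) = 8 * (k + 1) + 24 + 24 by ring,
      lucasStep_iterate_add_twenty_four p q (by omega),
      lucasStep_iterate_add_twenty_four p q (by omega)] at h
    rw [show 4 * (k + 7) = 4 * (k + 1) + 24 by ring,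
      lucasStep_iterate_add_twenty_four p q (by omega)]
    exact ih h

/-- For any positive integer `k`, if `3 ∣ u_{8k}` then `3 ∣ u_{4k}`. -/
theorem three_dvd_lucasU_four_mul (P Q : ℤ) (k : ℕ) (hk : 0 < k)
    (h : (3 : ℤ) ∣ lucasU P Q (8 * k)) : (3 : ℤ) ∣ lucasU P Q (4 * k) := by
  rw [three_dvd_lucasU_iff] at h ⊢
  exact lucasStep_iterate_four_mul P Q k hk h
end

section
/- For any positive integer n and distinct integers a, b: if n divides a^n − b^n, then n divides (a^n − b^n)/(a − b), i.e., n·(a − b) divides a^n − b^n. -/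
theorem natCast_pow_mul_sub_dvd_pow_sub_pow {R : Type*} [CommRing R] {p : ℕ} {a b : R}
    (hp : (p : R) ∣ a - b) (k : ℕ) :
    (p : R) ^ k * (a - b) ∣ a ^ p ^ k - b ^ p ^ k := by
  induction k with
  | zero => simp
  | succ k ih =>
    rw [pow_succ p k, pow_mul a, pow_mul b, ← geom_sum₂_mul, pow_succ', mul_assoc]
    exact mul_dvd_mul (dvd_geom_sum₂_self (hp.trans (sub_dvd_pow_sub_pow a b _))) ih

/-- For a positive integer `n` and distinct integers `a, b`:
if `n ∣ aⁿ - bⁿ` then `n ∣ (aⁿ - bⁿ)/(a - b)`, i.e. `n·(a-b) ∣ aⁿ - bⁿ`. -/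
theorem dvd_div_sub_of_dvd_pow_sub_pow (n : ℕ) (hn : 0 < n) (a b : ℤ) (hab : a ≠ b)
    (h : (n : ℤ) ∣ a ^ n - b ^ n) : (n : ℤ) * (a - b) ∣ a ^ n - b ^ n := by
  have hab' : a - b ≠ 0 := sub_ne_zero.mpr hab
  obtain ⟨s, hs⟩ := sub_dvd_pow_sub_pow a b n
  rw [hs, mul_comm (n : ℤ)]
  refine mul_dvd_mul_left _ ?_
  rw [Int.natCast_dvd, Nat.dvd_iff_prime_pow_dvd_dvd]
  intro p k hp hpk
  rw [← Int.natCast_dvd, Nat.cast_pow]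
  by_cases hd : (p : ℤ) ∣ a - b
  · obtain ⟨m, rfl⟩ := hpk
    have key := (natCast_pow_mul_sub_dvd_pow_sub_pow hd k).trans
      (sub_dvd_pow_sub_pow (a ^ p ^ k) (b ^ p ^ k) m)
    rw [← pow_mul, ← pow_mul, hs, mul_comm] at key
    exact (mul_dvd_mul_iff_left hab').mp key
  · have hpow : (p : ℤ) ^ k ∣ (a - b) * s := by
      rw [← hs]
      exact dvd_trans (by exact_mod_cast hpk) h
    exact (((Nat.prime_iff_prime_int.mp hp).coprime_iff_not_dvd.mpr hd).pow_left).dvd_of_dvd_mul_left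
      hpow
end

section
/- Every prime p divides some element of S (i.e., for every prime p there exists a positive integer n with n ∣ u_n and p ∣ n) if and only if every prime divisor of Q also divides P (i.e., all primes are regular). -/
theorem lucasU_add_and_succ (P Q : ℤ) (m n : ℕ) :
    lucasU P Q (m + n) = lucasU P Q (m + 1) * lucasU P Q n + lucasU P Q m * lucasU P Q (n + 1)
        - P * lucasU P Q m * lucasU P Q n ∧
      lucasU P Q (m + n + 1) =
        lucasU P Q (m + 1) * lucasU P Q (n + 1) - Q * lucasU P Q m * lucasU P Q n := by
  induction n with
  | zero => simp [lucasU]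
  | succ n ih =>
    obtain ⟨h₀, h₁⟩ := ih
    refine ⟨?_, ?_⟩
    · rw [← add_assoc, h₁, lucasU_add_two]
      ring
    · rw [← add_assoc, lucasU_add_two, h₁, h₀, lucasU_add_two]
      ring

theorem lucasU_mul_expansion (P Q : ℤ) (n k : ℕ) :
    (∃ t, lucasU P Q (n * (k + 1)) =
        lucasU P Q n * ((k + 1) * lucasU P Q (n + 1) ^ k + lucasU P Q n * t)) ∧
      ∃ s, lucasU P Q (n * (k + 1) + 1) = lucasU P Q (n + 1) ^ (k + 1) + lucasU P Q n * s := by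
  induction k with
  | zero => exact ⟨⟨0, by simp⟩, ⟨0, by simp⟩⟩
  | succ k ih =>
    obtain ⟨⟨t, ht⟩, s, hs⟩ := ih
    obtain ⟨h₀, h₁⟩ := lucasU_add_and_succ P Q (n * (k + 1)) n
    rw [mul_add_one n (k + 1), h₀, h₁, ht, hs]
    set a := lucasU P Q n
    set c := lucasU P Q (n + 1)
    refine ⟨⟨s + t * c - P * ((k + 1) * c ^ k + a * t), ?_⟩,
      ⟨s * c - Q * a * ((k + 1) * c ^ k + a * t), ?_⟩⟩ <;> push_cast <;> ring

theorem lucasU_dvd_lucasU (P Q : ℤ) {m n : ℕ} (h : m ∣ n) : lucasU P Q m ∣ lucasU P Q n := by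
  obtain ⟨k, rfl⟩ := h
  cases k with
  | zero => simp [lucasU]
  | succ k =>
    obtain ⟨⟨t, ht⟩, -⟩ := lucasU_mul_expansion P Q m k
    exact ⟨_, ht⟩

theorem mul_dvd_lucasU_mul {P Q : ℤ} {n k : ℕ} (hn : (n : ℤ) ∣ lucasU P Q n)
    (hk : (k : ℤ) ∣ lucasU P Q n) : ((n * k : ℕ) : ℤ) ∣ lucasU P Q (n * k) := by
  cases k with
  | zero => simp [lucasU]
  | succ k =>
    obtain ⟨⟨t, ht⟩, -⟩ := lucasU_mul_expansion P Q n k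
    rw [ht, Nat.cast_mul]
    refine mul_dvd_mul hn (dvd_add ?_ (hk.mul_right t))
    push_cast
    exact dvd_mul_right _ _

theorem lcm_dvd_lucasU_lcm {P Q : ℤ} {m n : ℕ} (hm : (m : ℤ) ∣ lucasU P Q m)
    (hn : (n : ℤ) ∣ lucasU P Q n) : ((m.lcm n : ℕ) : ℤ) ∣ lucasU P Q (m.lcm n) := by
  rw [Int.natCast_dvd] at *
  exact Nat.lcm_dvd
    (hm.trans (Int.natAbs_dvd_natAbs.mpr (lucasU_dvd_lucasU P Q (Nat.dvd_lcm_left m n))))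
    (hn.trans (Int.natAbs_dvd_natAbs.mpr (lucasU_dvd_lucasU P Q (Nat.dvd_lcm_right m n))))

theorem exists_dvd_lucasU_of_forall_prime {P Q : ℤ} (N : ℕ) (hN : N ≠ 0)
    (h : ∀ q : ℕ, q.Prime → q ∣ N → ∃ n : ℕ, 0 < n ∧ (n : ℤ) ∣ lucasU P Q n ∧ q ∣ n) :
    ∃ n : ℕ, 0 < n ∧ (n : ℤ) ∣ lucasU P Q n ∧ N ∣ n := by
  induction N using induction_on_primes with
  | zero => exact absurd rfl hN
  | one => exact ⟨1, one_pos, by simp, dvd_rfl⟩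
  | prime_mul q a hq ih =>
    obtain ⟨m, hm0, hm, ham⟩ := ih (right_ne_zero_of_mul hN)
      fun r hr hra => h r hr (hra.mul_left q)
    obtain ⟨n, hn0, hn, hqn⟩ := h q hq (dvd_mul_right q a)
    have hl := lcm_dvd_lucasU_lcm hm hn
    have hql : q ∣ m.lcm n := hqn.trans (Nat.dvd_lcm_right m n)
    refine ⟨m.lcm n * q, Nat.mul_pos (Nat.lcm_pos hm0 hn0) hq.pos,
      mul_dvd_lucasU_mul hl ((Int.natCast_dvd_natCast.mpr hql).trans hl), ?_⟩
    rw [mul_comm q a]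
    exact mul_dvd_mul_right (ham.trans (Nat.dvd_lcm_left m n)) q

theorem lucasU_modEq_pow {P Q : ℤ} {d : ℤ} (h : d ∣ Q) (n : ℕ) :
    lucasU P Q (n + 1) ≡ P ^ n [ZMOD d] := by
  induction n with
  | zero => simp [lucasU]
  | succ n ih =>
    have hQ : Q * lucasU P Q n ≡ 0 [ZMOD d] := Int.modEq_zero_iff_dvd.mpr (h.mul_right _)
    simpa [lucasU_add_two, pow_succ'] using (ih.mul_left P).sub hQ

theorem twelve_dvd_lucasU {P Q : ℤ} (h2 : (2 : ℤ) ∣ Q → (2 : ℤ) ∣ P)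
    (h3 : (3 : ℤ) ∣ Q → (3 : ℤ) ∣ P) : (12 : ℤ) ∣ lucasU P Q 12 := by
  have key : ∀ x y : ZMod 12, (y.val % 2 = 0 → x.val % 2 = 0) → (y.val % 3 = 0 → x.val % 3 = 0) →
      x * (x ^ 2 - y) * (x ^ 2 - 3 * y) * (x ^ 2 - 2 * y) *
        (x ^ 4 - 4 * x ^ 2 * y + y ^ 2) = 0 := by decide
  have hval (z : ℤ) : ((z : ZMod 12).val : ℤ) = z % 12 := ZMod.val_intCast z
  have h := key P Q (by have := hval P; have := hval Q; omega)
    (by have := hval P; have := hval Q; omega)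
  have hu : lucasU P Q 12 = P * (P ^ 2 - Q) * (P ^ 2 - 3 * Q) * (P ^ 2 - 2 * Q) *
      (P ^ 4 - 4 * P ^ 2 * Q + Q ^ 2) := by
    simp only [lucasU]
    ring
  rw [hu]
  refine (ZMod.intCast_zmod_eq_zero_iff_dvd _ 12).mp ?_
  push_cast
  exact h

theorem lucasU_mul_sub {K : Type*} [CommRing K] {P Q : ℤ} {a b : K} (hP : (P : K) = a + b)
    (hQ : (Q : K) = a * b) (n : ℕ) : (lucasU P Q n : K) * (a - b) = a ^ n - b ^ n := by
  induction n using Nat.twoStepInduction with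
  | zero => simp [lucasU]
  | one => simp [lucasU]
  | more n ih₀ ih₁ =>
    rw [lucasU_add_two]
    push_cast
    rw [hP, hQ]
    linear_combination (a + b) * ih₁ - a * b * ih₀

theorem lucasU_succ_of_double_root {K : Type*} [CommRing K] {P Q : ℤ} {a : K}
    (hP : (P : K) = a + a) (hQ : (Q : K) = a * a) (n : ℕ) :
    (lucasU P Q (n + 1) : K) = (n + 1) * a ^ n := by
  induction n using Nat.twoStepInduction with
  | zero => simp [lucasU]
  | one => simp [lucasU, hP, two_mul, one_add_one_eq_two]
  | more n ih₀ ih₁ =>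
    rw [lucasU_add_two]
    push_cast at *
    rw [hP, hQ, ih₀, ih₁]
    ring

theorem dvd_lucasU_self_or_sq_sub_one {P Q : ℤ} {p : ℕ} (hp : p.Prime) (hQ : ¬ (p : ℤ) ∣ Q) :
    (p : ℤ) ∣ lucasU P Q p ∨ (p : ℤ) ∣ lucasU P Q (p ^ 2 - 1) := by
  have := Fact.mk hp
  let K := AlgebraicClosure (ZMod p)
  have : CharP K p := charP_of_injective_algebraMap (algebraMap (ZMod p) K).injective p
  obtain ⟨a, ha⟩ : ∃ a : K, a ^ 2 - (P : K) * a + (Q : K) = 0 := by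
    have hdeg : (Polynomial.C (1 : K) * Polynomial.X ^ 2 + Polynomial.C (-(P : K)) * Polynomial.X +
        Polynomial.C (Q : K)).degree ≠ 0 := by
      rw [Polynomial.degree_quadratic one_ne_zero]
      decide
    obtain ⟨a, ha⟩ := IsAlgClosed.exists_root _ hdeg
    refine ⟨a, ?_⟩
    simp only [Polynomial.IsRoot, Polynomial.eval_add, Polynomial.eval_mul, Polynomial.eval_C,
      Polynomial.eval_pow, Polynomial.eval_X] at ha
    linear_combination ha
  obtain ⟨b, hb⟩ : ∃ b : K, (P : K) = a + b := ⟨P - a, by ring⟩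
  have hab : (Q : K) = a * b := by linear_combination ha + a * hb
  have hQK : (Q : K) ≠ 0 := by rwa [Ne, CharP.intCast_eq_zero_iff K p]
  simp only [← CharP.intCast_eq_zero_iff K p]
  rcases eq_or_ne a b with rfl | hne
  · left
    obtain ⟨m, rfl⟩ := Nat.exists_eq_add_of_le' hp.pos
    rw [lucasU_succ_of_double_root hb hab]
    have := CharP.cast_eq_zero K (m + 1)
    push_cast at this
    rw [this, zero_mul]
  · right
    have hadd : a ^ p + b ^ p = a + b := by
      rw [← add_pow_char, ← hb, ← map_intCast (algebraMap (ZMod p) K), ← map_pow, ZMod.pow_card]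
    have hmul : a ^ p * b ^ p = a * b := by
      rw [← mul_pow, ← hab, ← map_intCast (algebraMap (ZMod p) K), ← map_pow, ZMod.pow_card]
    have hroot : (a ^ p - a) * (a ^ p - b) = 0 := by
      linear_combination a ^ p * hadd - hmul
    have hsq : a ^ p ^ 2 = a ∧ b ^ p ^ 2 = b := by
      rw [sq, pow_mul, pow_mul]
      rcases mul_eq_zero.mp hroot with h | h
      · have h₁ : a ^ p = a := sub_eq_zero.mp h
        have h₂ : b ^ p = b := by linear_combination hadd - h₁
        simp [h₁, h₂]
      · have h₁ : a ^ p = b := sub_eq_zero.mp h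
        have h₂ : b ^ p = a := by linear_combination hadd - h₁
        simp [h₁, h₂]
    have hone {x : K} (hx : x ≠ 0) (h : x ^ p ^ 2 = x) : x ^ (p ^ 2 - 1) = 1 := by
      refine mul_right_cancel₀ hx ?_
      rw [← pow_succ, Nat.sub_add_cancel (Nat.one_le_pow _ _ hp.pos), h, one_mul]
    have ha0 : a ≠ 0 := by rintro rfl; simp [hab] at hQK
    have hb0 : b ≠ 0 := by rintro rfl; simp [hab] at hQK
    have h := lucasU_mul_sub hb hab (p ^ 2 - 1)
    rw [hone ha0 hsq.1, hone hb0 hsq.2, sub_self] at h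
    exact (mul_eq_zero.mp h).resolve_right (sub_ne_zero.mpr hne)

theorem lt_of_prime_dvd_sq_sub_one {p q : ℕ} (hp : p.Prime) (hp3 : 3 ≤ p) (hq : q.Prime)
    (h : q ∣ p ^ 2 - 1) : q < p := by
  have hfac : p ^ 2 - 1 = (p + 1) * (p - 1) := by simpa using Nat.sq_sub_sq p 1
  rw [hfac] at h
  rcases hq.dvd_mul.mp h with h | h
  · obtain ⟨k, hk⟩ := hp.odd_of_ne_two (by omega)
    have h2 : q ∣ 2 * (k + 1) := by
      rwa [show 2 * (k + 1) = p + 1 by omega]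
    rcases hq.dvd_mul.mp h2 with h | h <;> have := Nat.le_of_dvd (by omega) h <;> omega
  · have := Nat.le_of_dvd (by omega) h
    omega

theorem exists_dvd_lucasU_of_regular {P Q : ℤ}
    (hreg : ∀ p : ℕ, p.Prime → (p : ℤ) ∣ Q → (p : ℤ) ∣ P) (p : ℕ) (hp : p.Prime) :
    ∃ n : ℕ, 0 < n ∧ (n : ℤ) ∣ lucasU P Q n ∧ p ∣ n := by
  induction p using Nat.strong_induction_on with
  | _ p ih =>
  rcases lt_or_ge p 4 with hp4 | hp4
  · refine ⟨12, by norm_num, ?_, ?_⟩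
    · exact twelve_dvd_lucasU (hreg 2 Nat.prime_two) (hreg 3 Nat.prime_three)
    · have := hp.two_le
      interval_cases p <;> norm_num
  by_cases hQ : (p : ℤ) ∣ Q
  · refine ⟨p, hp.pos, ?_, dvd_rfl⟩
    obtain ⟨m, rfl⟩ := Nat.exists_eq_add_of_le' hp.two_le
    rw [lucasU_add_two]
    exact dvd_sub ((hreg _ hp hQ).mul_right _) (hQ.mul_right _)
  rcases dvd_lucasU_self_or_sq_sub_one (P := P) hp hQ with h | h
  · exact ⟨p, hp.pos, h, dvd_rfl⟩
  · have hN : p ^ 2 - 1 ≠ 0 := by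
      have : 1 < p ^ 2 := Nat.one_lt_pow two_ne_zero hp.one_lt
      omega
    obtain ⟨n, hn0, hn, hdvd⟩ := exists_dvd_lucasU_of_forall_prime (P := P) (Q := Q) _ hN
      fun q hq hqd => ih q (lt_of_prime_dvd_sq_sub_one hp (by omega) hq hqd) hq
    exact ⟨n * p, Nat.mul_pos hn0 hp.pos,
      mul_dvd_lucasU_mul hn (h.trans (lucasU_dvd_lucasU P Q hdvd)), dvd_mul_left p n⟩

/-- Every prime divides some element of `S` iff every prime divisor
of `Q` also divides `P` (i.e. all primes are regular). -/
theorem all_primes_in_P_S_iff_all_regular (P Q : ℤ) :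
    (∀ p : ℕ, p.Prime → ∃ n : ℕ, 0 < n ∧ (n : ℤ) ∣ lucasU P Q n ∧ p ∣ n) ↔
      (∀ p : ℕ, p.Prime → (p : ℤ) ∣ Q → (p : ℤ) ∣ P) := by
  refine ⟨fun h p hp hQ => ?_, exists_dvd_lucasU_of_regular⟩
  obtain ⟨n, hn0, hn, hpn⟩ := h p hp
  obtain ⟨m, rfl⟩ := Nat.exists_eq_add_of_le' hn0
  exact (Nat.prime_iff_prime_int.mp hp).dvd_of_dvd_pow
    ((lucasU_modEq_pow hQ m).dvd_iff.mp ((Int.natCast_dvd_natCast.mpr hpn).trans hn))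
end
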